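/- arXiv:1511.00548 — 7 statements merged into one kernel-verified Lean document; each statement's English description precedes it below -/
import Mathlib

section
/- Let G be a group, X a finite type, and φ : X → G a map such that the submonoid of G generated by the image of φ is all of G (so φ(X) is an inverse-closed generating set of G). Suppose G is virtually free, i.e. there exists a subgroup F of G of finite index that is a free group, and let H be a finitely generated subgroup of G. Then the generalised word problem GWP(G,H,X) = {w : List X | the product in G of the φ-images of the letters of w lies in H} is a context-free language over the alphabet X. -/
namespace GWPAux

/-! ### Grammars from finite families of languages -/

section Grammar
variable {X I : Type}

/-- interpretation of a symbol as a language -/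
def interp (L : I → Language X) : Symbol X I → Language X
  | .terminal x => ({[x]} : Set (List X))
  | .nonterminal i => L i

/-- interpretation of a sentential form -/
def sem (L : I → Language X) (s : List (Symbol X I)) : Language X :=
  (s.map (interp L)).prod

/-- admissible rules -/
def goodRules (L : I → Language X) : Set (ContextFreeRule X I) :=
  {r | r.output.length ≤ 2 ∧ sem L r.output ≤ L r.input}

theorem goodRules_finite [Finite X] [Finite I] (L : I → Language X) :
    (goodRules L).Finite := by
  have : Fintype X := Fintype.ofFinite X
  have : Fintype I := Fintype.ofFinite I
  have h1 : {l : List (Symbol X I) | l.length ≤ 2}.Finite := List.finite_length_le _ 2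
  have h2 : ((Set.univ : Set I) ×ˢ {l : List (Symbol X I) | l.length ≤ 2}).Finite :=
    Set.finite_univ.prod h1
  refine Set.Finite.of_finite_image (f := fun r => (r.input, r.output)) (h2.subset ?_) ?_
  · rintro _ ⟨r, hr, rfl⟩
    exact ⟨trivial, hr.1⟩
  · intro r _ r' _ h
    simp only [Prod.mk.injEq] at h
    exact ContextFreeRule.ext h.1 h.2

/-- the grammar -/
noncomputable def gram [Finite X] [Finite I] (L : I → Language X) (i : I) :
    ContextFreeGrammar X where
  NT := I
  initial := i
  rules := (goodRules_finite L).toFinset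

theorem sem_map_terminal (L : I → Language X) (w : List X) :
    w ∈ sem L (w.map Symbol.terminal) ∧
      ∀ v ∈ sem L (w.map Symbol.terminal), v = w := by
  induction w with
  | nil => simp [sem, Language.mem_one]
  | cons x w ih =>
    have e : sem L ((x :: w).map Symbol.terminal)
      = interp L (.terminal x) * sem L (w.map Symbol.terminal) := by simp [sem]
    rw [e]
    constructor
    · exact Language.mem_mul.2 ⟨[x], rfl, w, ih.1, rfl⟩
    · intro v hv
      obtain ⟨a, ha, b, hb, rfl⟩ := Language.mem_mul.1 hv
      have ha' : a = [x] := ha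
      rw [ih.2 b hb, ha']
      rfl

theorem sem_append (L : I → Language X) (u v : List (Symbol X I)) :
    sem L (u ++ v) = sem L u * sem L v := by simp [sem]

theorem sem_single (L : I → Language X) (i : I) :
    sem L [Symbol.nonterminal i] = L i := by simp [sem, interp]

theorem rewrites_sem (L : I → Language X) (r : ContextFreeRule X I)
    (h : sem L r.output ≤ L r.input) (p q : List (Symbol X I)) :
    sem L (p ++ r.output ++ q) ≤ sem L (p ++ [Symbol.nonterminal r.input] ++ q) := by
  rw [sem_append, sem_append, sem_append, sem_append, sem_single]
  gcongr

theorem produces_sem [Finite X] [Finite I] (L : I → Language X) (i : I)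
    {u v : List (Symbol X I)} (h : (gram L i).Produces u v) : sem L v ≤ sem L u := by
  obtain ⟨r, hr, h⟩ := h
  have hr' : r ∈ goodRules L := (goodRules_finite L).mem_toFinset.1 hr
  obtain ⟨p, q, rfl, rfl⟩ := h.exists_parts
  exact rewrites_sem L r hr'.2 p q

theorem derives_sem [Finite X] [Finite I] (L : I → Language X) (i : I)
    {u v : List (Symbol X I)} (h : (gram L i).Derives u v) : sem L v ≤ sem L u := by
  induction h with
  | refl => exact le_rfl
  | tail _ h ih => exact (produces_sem L i h).trans ih

theorem derives_short [Finite X] [Finite I] (L : I → Language X) (i j : I) (w : List X)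
    (hw : w.length ≤ 2) (h : w ∈ L j) :
    (gram L i).Derives [Symbol.nonterminal j] (w.map Symbol.terminal) := by
  refine Relation.ReflTransGen.single ⟨⟨j, w.map Symbol.terminal⟩, ?_, ?_⟩
  · refine (goodRules_finite L).mem_toFinset.2 ⟨(List.length_map _).trans_le hw, ?_⟩
    intro v hv
    rw [(sem_map_terminal L w).2 v hv]
    exact h
  · exact ContextFreeRule.Rewrites.input_output

theorem derives_pair [Finite X] [Finite I] (L : I → Language X) (i j a b : I) (u v : List X)
    (h : ∀ u ∈ L a, ∀ v ∈ L b, u ++ v ∈ L j)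
    (hu : (gram L i).Derives [Symbol.nonterminal a] (u.map Symbol.terminal))
    (hv : (gram L i).Derives [Symbol.nonterminal b] (v.map Symbol.terminal)) :
    (gram L i).Derives [Symbol.nonterminal j] ((u ++ v).map Symbol.terminal) := by
  have h1 : (gram L i).Produces [Symbol.nonterminal j]
      ([Symbol.nonterminal a] ++ [Symbol.nonterminal b]) := by
    refine ⟨⟨j, [Symbol.nonterminal a] ++ [Symbol.nonterminal b]⟩, ?_, ?_⟩
    · refine (goodRules_finite L).mem_toFinset.2 ⟨le_refl 2, ?_⟩
      intro w hw
      have e : sem L ([Symbol.nonterminal a] ++ [Symbol.nonterminal b]) = L a * L b := by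
        rw [sem_append, sem_single, sem_single]
      have hw' : w ∈ L a * L b := by rw [← e]; exact hw
      obtain ⟨p, hp, q, hq, rfl⟩ := Language.mem_mul.1 hw'
      exact h p hp q hq
    · exact ContextFreeRule.Rewrites.input_output
  refine h1.trans_derives ?_
  rw [List.map_append]
  exact (hu.append_right _).trans (hv.append_left _)

theorem isContextFree_of_complete [Finite X] [Finite I] (L : I → Language X) (i : I)
    (h : ∀ w ∈ L i, (gram L i).Derives [Symbol.nonterminal i] (w.map Symbol.terminal)) :
    (L i).IsContextFree := by
  refine ⟨gram L i, ?_⟩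
  ext w
  rw [ContextFreeGrammar.mem_language_iff]
  constructor
  · intro hw
    have := derives_sem L i hw (sem_map_terminal L w).1
    have e : sem L [Symbol.nonterminal i] = L i := sem_single L i
    rw [← e]
    exact this
  · exact h w

end Grammar

/-! ### Free groups -/

section Free
variable {Y : Type}

open FreeGroup

theorem prefix_reduce [DecidableEq Y] (m : List (Y × Bool)) :
    ∀ (W r : List (Y × Bool)), IsReduced (m ++ r) → W.length ≤ r.length →
      m <+: reduce (m ++ r ++ W) := by
  intro W
  induction W with
  | nil =>
    intro r h _
    rw [List.append_nil, h.reduce_eq]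
    exact List.prefix_append m r
  | cons x W ih =>
    intro r h hl
    rcases List.eq_nil_or_concat r with rfl | ⟨r', y, rfl⟩
    · simp at hl
    · by_cases hxy : y.1 = x.1 ∧ y.2 = !x.2
      · have : Red.Step (m ++ (r' ++ [y]) ++ x :: W) (m ++ r' ++ W) := by
          obtain ⟨y1, y2⟩ := y
          obtain ⟨x1, x2⟩ := x
          obtain ⟨h1, h2⟩ := hxy
          simp only at h1 h2
          subst h1 h2
          have := @Red.Step.not_rev _ (m ++ r') W y1 x2
          simpa using this
        rw [List.concat_eq_append] at *
        rw [reduce.Step.eq this]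
        apply ih
        · exact h.infix ⟨[], [y], by simp⟩
        · simpa using hl
      · have := ih (r' ++ [y] ++ [x]) ?_ ?_
        · simpa using this
        · have := IsReduced.append_overlap (L₁ := m ++ r') (L₂ := [y]) (L₃ := [x])
            (by simpa using h) ?_ (by simp)
          · simpa using this
          · rw [List.singleton_append, isReduced_cons_cons]
            refine ⟨fun e => ?_, IsReduced.singleton⟩
            by_contra hne
            exact hxy ⟨e, by cases hy : y.2 <;> cases hx : x.2 <;> simp_all⟩
        · simp at hl ⊢
          omega

theorem key_free [DecidableEq Y] (K : ℕ) (hK : 1 ≤ K) (f : ℕ → FreeGroup Y) (n : ℕ) (hn : 2 ≤ n)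
    (h0 : f 0 = 1) (hstep : ∀ j < n, norm ((f j)⁻¹ * f (j + 1)) ≤ K)
    (hend : norm (f n) ≤ 3 * K) :
    ∃ i, 0 < i ∧ i < n ∧ norm (f i) ≤ 3 * K ∧ norm ((f i)⁻¹ * f n) ≤ 3 * K := by
  by_cases hd : norm (f n) ≤ 2 * K
  · refine ⟨1, by omega, by omega, ?_, ?_⟩
    · have := hstep 0 (by omega)
      simp [h0] at this
      omega
    · have := hstep 0 (by omega)
      simp [h0] at this
      have h2 := norm_mul_le (f 1)⁻¹ (f n)
      rw [norm_inv_eq] at h2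
      omega
  · push Not at hd
    set m := (f n).toWord.take K with hm
    have hlen : (f n).toWord.length = norm (f n) := rfl
    have hml : m.length = K := by simp [hm]; omega
    have hex : ∃ i, m <+: (f i).toWord := ⟨n, List.take_prefix _ _⟩
    classical
    let i := Nat.find hex
    have hi : m <+: (f i).toWord := Nat.find_spec hex
    have hin : i ≤ n := Nat.find_min' hex (List.take_prefix _ _)
    have hi0 : i ≠ 0 := by
      intro h
      rw [h, h0, toWord_one] at hi
      have := hi.length_le
      rw [hml, List.length_nil] at this
      omega
    obtain ⟨k, hk⟩ := Nat.exists_eq_succ_of_ne_zero hi0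
    have hprev : ¬ m <+: (f k).toWord := Nat.find_min hex (by change k < i; omega)
    obtain ⟨r, hr⟩ := hi
    have hrl : r.length ≤ K := by
      by_contra hlt
      push Not at hlt
      apply hprev
      have e : f k = f i * ((f k)⁻¹ * f (k + 1))⁻¹ := by
        rw [hk]; simp
      have hnn := hstep k (by omega)
      rw [← norm_inv_eq] at hnn
      rw [e, toWord_mul, ← hr]
      apply prefix_reduce
      · rw [hr]; exact isReduced_toWord
      · exact le_trans hnn hlt.le
    have hfi : f i = mk m * mk r := by
      rw [mul_mk, hr, mk_toWord]
    have hfn : f n = mk m * mk ((f n).toWord.drop K) := by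
      rw [mul_mk, hm, List.take_append_drop, mk_toWord]
    have hil : norm (f i) = K + r.length := by
      change (f i).toWord.length = _
      rw [← hr, List.length_append, hml]
    refine ⟨i, by omega, ?_, by omega, ?_⟩
    · refine lt_of_le_of_ne hin ?_
      intro h
      rw [h] at hil
      omega
    · have e : (f i)⁻¹ * f n = (mk r)⁻¹ * mk ((f n).toWord.drop K) := by
        rw [hfi]
        nth_rewrite 1 [hfn]
        group
      rw [e]
      have h1 := norm_mul_le (mk r)⁻¹ (mk ((f n).toWord.drop K))
      rw [norm_inv_eq] at h1
      have h2 : norm (mk r) ≤ r.length := norm_mk_le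
      have h3 : norm (mk ((f n).toWord.drop K)) ≤ ((f n).toWord.drop K).length := norm_mk_le
      rw [List.length_drop] at h3
      omega

theorem finite_of_fg (h : Group.FG (FreeGroup Y)) : Finite Y := by
  classical
  obtain ⟨S, hS⟩ := h.out
  have h1 : Finite (FreeGroup Y →* Multiplicative (ZMod 2)) := by
    have : Finite (Multiplicative (ZMod 2)) := inferInstanceAs (Finite (ZMod 2))
    refine Finite.of_injective
      (β := S → Multiplicative (ZMod 2)) (fun f s => f s) ?_
    intro f g hfg
    refine MonoidHom.eq_of_eqOn_dense hS ?_
    intro x hx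
    exact congrFun hfg ⟨x, hx⟩
  have h2 : Finite (Y → Multiplicative (ZMod 2)) := Finite.of_equiv _ FreeGroup.lift.symm
  refine Finite.of_injective
    (fun y : Y => (fun z => if z = y then Multiplicative.ofAdd 1 else 1 :
      Y → Multiplicative (ZMod 2))) ?_
  intro y z hyz
  by_contra hne
  have := congrFun hyz y
  simp [hne] at this

theorem ball_finite [DecidableEq Y] [Finite Y] (R : ℕ) :
    {f : FreeGroup Y | norm f ≤ R}.Finite := by
  refine Set.Finite.of_finite_image (f := toWord)
    ((List.finite_length_le (Y × Bool) R).subset ?_) toWord_injective.injOn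
  rintro _ ⟨f, hf, rfl⟩
  exact hf

end Free

/-! ### Virtually free groups -/

theorem key_group (G : Type) [Group G] [Group.FG G] (F : Subgroup G) (hF : F.FiniteIndex)
    (hfree : IsFreeGroup F) (S : Set G) (hS : S.Finite) :
    ∃ U : Set G, U.Finite ∧ 1 ∈ U ∧ ∀ W : List G, (∀ s ∈ W, s ∈ S) → 2 ≤ W.length →
      W.prod ∈ U → ∃ W₁ W₂, W = W₁ ++ W₂ ∧ W₁ ≠ [] ∧ W₂ ≠ [] ∧ W₁.prod ∈ U ∧ W₂.prod ∈ U := by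
  classical
  let e := IsFreeGroup.toFreeGroup F
  have : Group.FG F := inferInstance
  have hY : Finite (IsFreeGroup.Generators F) :=
    finite_of_fg (Group.fg_of_surjective (f := e.toMonoidHom) e.surjective)
  have : Finite (G ⧸ F) := Subgroup.finite_quotient_of_finiteIndex
  let q : G → G := fun g => ((g⁻¹ : G) : G ⧸ F).out
  let Q : Set G := Set.range (fun x : G ⧸ F => x.out)
  have hQ : Q.Finite := Set.finite_range _
  have hqQ : ∀ g, q g ∈ Q := fun g => ⟨_, rfl⟩
  have hmem : ∀ g, g * q g ∈ F := by
    intro g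
    have : ((q g : G) : G ⧸ F) = ((g⁻¹ : G) : G ⧸ F) := Quotient.out_eq' _
    have h2 := QuotientGroup.eq.1 this.symm
    simpa using h2
  have hqinv : ∀ b ∈ F, ∀ t ∈ Q, q (b * t⁻¹) = t := by
    rintro b hb _ ⟨x, rfl⟩
    have : (((b * x.out⁻¹)⁻¹ : G) : G ⧸ F) = x := by
      conv_rhs => rw [← Quotient.out_eq' x]
      apply QuotientGroup.eq.2
      simpa using hb
    change ((((b * x.out⁻¹)⁻¹ : G) : G ⧸ F)).out = x.out
    rw [this]
  let N : G → ℕ := fun g => if h : g ∈ F then FreeGroup.norm (e ⟨g, h⟩) else 0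
  have hfin : (Set.image (fun z : G × G × G => N (z.1⁻¹ * z.2.1 * z.2.2)) (Q ×ˢ S ×ˢ Q)).Finite :=
    (hQ.prod (hS.prod hQ)).image _
  obtain ⟨K0, hK0⟩ := hfin.bddAbove
  let K := K0 + 1
  let P : G → FreeGroup (IsFreeGroup.Generators F) := fun g => e ⟨g * q g, hmem g⟩
  have hPmul : ∀ g g', (P g)⁻¹ * P g' = e (⟨g * q g, hmem g⟩⁻¹ * ⟨g' * q g', hmem g'⟩) := by
    intro g g'
    simp [P]
  have hstep : ∀ g, ∀ s ∈ S, FreeGroup.norm ((P g)⁻¹ * P (g * s)) ≤ K := by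
    intro g s hs
    have h1 : N ((q g)⁻¹ * s * q (g * s)) ≤ K0 :=
      hK0 ⟨(q g, s, q (g * s)), ⟨hqQ _, hs, hqQ _⟩, rfl⟩
    have heq : (q g)⁻¹ * s * q (g * s) = (g * q g)⁻¹ * (g * s * q (g * s)) := by group
    have h2 : (q g)⁻¹ * s * q (g * s) ∈ F := by
      rw [heq]; exact F.mul_mem (F.inv_mem (hmem _)) (hmem _)
    have h3 : N ((q g)⁻¹ * s * q (g * s)) = FreeGroup.norm (e ⟨_, h2⟩) := dif_pos h2
    rw [hPmul]
    have h4 : (⟨g * q g, hmem g⟩⁻¹ * ⟨g * s * q (g * s), hmem _⟩ : F) = ⟨_, h2⟩ := by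
      apply Subtype.ext
      exact heq.symm
    rw [h4, ← h3]
    omega
  let B : Set F := {b | FreeGroup.norm (e b) ≤ 3 * K}
  have hB : B.Finite := (ball_finite (3 * K)).preimage e.injective.injOn
  let U : Set G := (fun z : G × F × G => z.1 * z.2.1 * z.2.2⁻¹) '' (Q ×ˢ B ×ˢ Q)
  have hU : ∀ g g', FreeGroup.norm ((P g)⁻¹ * P g') ≤ 3 * K → g⁻¹ * g' ∈ U := by
    intro g g' h
    refine ⟨(q g, ⟨g * q g, hmem g⟩⁻¹ * ⟨g' * q g', hmem g'⟩, q g'), ⟨hqQ _, ?_, hqQ _⟩, ?_⟩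
    · change FreeGroup.norm _ ≤ _
      rw [← hPmul]; exact h
    · simp only [Subgroup.coe_mul, Subgroup.coe_inv]
      group
  refine ⟨U, (hQ.prod (hB.prod hQ)).image _, ?_, ?_⟩
  · have := hU 1 1 (by simp)
    simpa using this
  intro W hW hlen hprod
  obtain ⟨⟨t, b, t'⟩, ⟨ht, hb, ht'⟩, hz⟩ := hprod
  simp only at hz ht hb ht'
  let g : ℕ → G := fun j => t⁻¹ * (W.take j).prod
  have hP0 : P (g 0) = 1 := by
    have h1 : q (g 0) = t := by
      have := hqinv 1 F.one_mem t ht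
      simpa [g] using this
    have : (⟨g 0 * q (g 0), hmem _⟩ : F) = 1 := by
      apply Subtype.ext
      change g 0 * q (g 0) = 1
      rw [h1]; simp [g]
    change e _ = 1
    rw [this, map_one]
  have hgn : g W.length = b * t'⁻¹ := by
    simp only [g, List.take_length]
    rw [← hz]; group
  have hPn : P (g W.length) = e b := by
    have h1 : q (g W.length) = t' := by
      rw [hgn]; exact hqinv b b.2 t' ht'
    change e _ = e b
    congr 1
    apply Subtype.ext
    change g W.length * q (g W.length) = b
    rw [h1, hgn]; group
  have hg : ∀ j (hj : j < W.length), g (j + 1) = g j * W[j] := by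
    intro j hj
    simp only [g, List.prod_take_succ W j hj, mul_assoc]
  obtain ⟨i, hi0, hin, hi1, hi2⟩ := key_free K (by omega) (fun j => P (g j)) W.length hlen hP0
    (by
      intro j hj
      rw [hg j hj]
      exact hstep _ _ (hW _ (List.getElem_mem hj)))
    (by rw [hPn]; exact hb)
  refine ⟨W.take i, W.drop i, (List.take_append_drop _ _).symm, ?_, ?_, ?_, ?_⟩
  · intro h
    have := congrArg List.length h
    rw [List.length_take, List.length_nil] at this
    omega
  · intro h
    have := congrArg List.length h
    rw [List.length_drop, List.length_nil] at this
    omega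
  · have := hU (g 0) (g i) (by rw [hP0]; simpa using hi1)
    simpa [g] using this
  · have h := hU (g i) (g W.length) hi2
    have h2 : (g i)⁻¹ * g W.length = (W.drop i).prod := by
      simp only [g, List.take_length]
      rw [← List.prod_take_mul_prod_drop W i]
      group
    rwa [h2] at h

end GWPAux

open GWPAux

/-- If `G` is a finitely generated virtually free group (generated as a monoid by the
image of `φ : X → G` with `X` finite) and `H` is a finitely generated subgroup of `G`,
then the generalised word problem `GWP(G,H,X)` is a context-free language. -/
theorem gwp_contextFree_of_virtuallyFree
    (G : Type) [Group G] (X : Type) [Fintype X] (φ : X → G)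
    (hgen : Submonoid.closure (Set.range φ) = ⊤)
    (hvf : ∃ F : Subgroup G, F.FiniteIndex ∧ IsFreeGroup F)
    (H : Subgroup G) (hH : H.FG) :
    Language.IsContextFree {w : List X | (w.map φ).prod ∈ H} := by
  classical
  obtain ⟨F, hF, hfree⟩ := hvf
  have : Monoid.FG G :=
    Monoid.fg_iff.2 ⟨Set.range φ, hgen, Set.finite_range φ⟩
  have : Group.FG G := Group.fg_iff_monoid_fg.2 inferInstance
  obtain ⟨Z, hZ⟩ := hH
  let Z' : Set G := (Z : Set G) ∪ (Z : Set G)⁻¹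
  have hZfin : Z'.Finite := Z.finite_toSet.union Z.finite_toSet.inv
  have hZH : ∀ z ∈ Z', z ∈ H := by
    have h1 : ∀ z ∈ Z, z ∈ H := fun z hz => hZ ▸ Subgroup.subset_closure hz
    rintro z (hz | hz)
    · exact h1 z hz
    · simpa using H.inv_mem (h1 _ hz)
  have hHword : ∀ h ∈ H, ∃ v : List G, (∀ z ∈ v, z ∈ Z') ∧ v.prod = h := by
    intro h hh
    rw [← hZ, ← Subgroup.mem_toSubmonoid, Subgroup.closure_toSubmonoid] at hh
    exact Submonoid.exists_list_of_mem_closure hh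
  obtain ⟨U, hUfin, hU1, hU⟩ := key_group G F hF hfree (Set.range φ ∪ Z')
    ((Set.finite_range φ).union hZfin)
  have : Finite U := hUfin
  let ev : List X → G := fun w => (w.map φ).prod
  have hev : ∀ u v, ev (u ++ v) = ev u * ev v := by intro u v; simp [ev]
  let L : U ⊕ U → Language X := fun i => match i with
    | .inl g => {w : List X | ev w = g}
    | .inr g => {w : List X | (g : G)⁻¹ * ev w ∈ H}
  let one : U := ⟨1, hU1⟩
  have hL : ({w : List X | (w.map φ).prod ∈ H} : Language X) = L (.inr one) := by
    ext w
    change ev w ∈ H ↔ (1 : G)⁻¹ * ev w ∈ H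
    simp
  change Language.IsContextFree ({w : List X | (w.map φ).prod ∈ H} : Language X)
  rw [hL]
  apply isContextFree_of_complete
  have hN : ∀ n : ℕ, ∀ w : List X, w.length ≤ n → ∀ g : U, ev w = g →
      (gram L (.inr one)).Derives [Symbol.nonterminal (Sum.inl g : U ⊕ U)]
        (w.map Symbol.terminal) := by
    intro n
    induction n with
    | zero =>
      intro w hw g hg
      exact derives_short L _ _ w (by omega) hg
    | succ n ih =>
      intro w hw g hg
      by_cases hs : w.length ≤ 2
      · exact derives_short L _ _ w hs hg
      obtain ⟨W₁, W₂, hW, hn1, hn2, hp1, hp2⟩ := hU (w.map φ)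
        (by
          intro s hs
          obtain ⟨x, _, rfl⟩ := List.mem_map.1 hs
          exact Or.inl ⟨x, rfl⟩)
        (by simp; omega) (by change ev w ∈ U; rw [hg]; exact g.2)
      obtain ⟨u, v, rfl, rfl, rfl⟩ := List.map_eq_append_iff.1 hW
      have hu0 : 0 < u.length := List.length_pos_iff.2 (by simpa using hn1)
      have hv0 : 0 < v.length := List.length_pos_iff.2 (by simpa using hn2)
      rw [List.length_append] at hw
      refine derives_pair L _ _ (.inl ⟨ev u, hp1⟩) (.inl ⟨ev v, hp2⟩) u v ?_
        (ih u (by omega) _ rfl) (ih v (by omega) _ rfl)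
      intro a ha b hb
      have ha' : ev a = ev u := ha
      have hb' : ev b = ev v := hb
      change ev (a ++ b) = g
      rw [hev, ha', hb', ← hev, hg]
  have hM : ∀ n : ℕ, ∀ (w : List X) (v : List G), w.length + v.length ≤ n →
      (∀ z ∈ v, z ∈ Z') → ∀ g : U, ev w * v.prod = g →
      (gram L (.inr one)).Derives [Symbol.nonterminal (Sum.inr g : U ⊕ U)]
        (w.map Symbol.terminal) := by
    have hvH : ∀ v : List G, (∀ z ∈ v, z ∈ Z') → v.prod ∈ H := fun v hv =>
      H.list_prod_mem (fun z hz => hZH z (hv z hz))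
    have hLmem : ∀ (w : List X) (v : List G), (∀ z ∈ v, z ∈ Z') → ∀ g : U,
        ev w * v.prod = g → w ∈ L (.inr g) := by
      intro w v hv g hg
      change (g : G)⁻¹ * ev w ∈ H
      rw [← hg]
      simpa using H.inv_mem (hvH v hv)
    intro n
    induction n with
    | zero =>
      intro w v hl hv g hg
      exact derives_short L _ _ w (by omega) (hLmem w v hv g hg)
    | succ n ih =>
      intro w v hl hv g hg
      by_cases hs : w.length + v.length ≤ 2
      · exact derives_short L _ _ w (by omega) (hLmem w v hv g hg)
      obtain ⟨W₁, W₂, hW, hn1, hn2, hp1, hp2⟩ := hU (w.map φ ++ v)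
        (by
          intro s hs
          rcases List.mem_append.1 hs with hs | hs
          · obtain ⟨x, _, rfl⟩ := List.mem_map.1 hs
            exact Or.inl ⟨x, rfl⟩
          · exact Or.inr (hv s hs))
        (by simp; omega)
        (by rw [List.prod_append]; change ev w * v.prod ∈ U; rw [hg]; exact g.2)
      have hl1 := List.length_pos_iff.2 hn1
      have hl2 := List.length_pos_iff.2 hn2
      rcases List.append_eq_append_iff.1 hW with ⟨c, rfl, rfl⟩ | ⟨c, hc, rfl⟩
      · rw [List.length_append] at hl
        have hgp : (ev w * c.prod) * W₂.prod = g := by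
          rw [← hg, List.prod_append, mul_assoc]
        have hp1' : ev w * c.prod ∈ U := by rw [List.prod_append] at hp1; exact hp1
        have hW2 : W₂.prod ∈ H := hvH _ (fun z hz => hv z (List.mem_append_right _ hz))
        have := derives_pair L (.inr one) (.inr g) (.inr ⟨ev w * c.prod, hp1'⟩) (.inl one) w []
          ?_ (ih w c (by omega) (fun z hz => hv z (List.mem_append_left _ hz)) _ rfl)
          (hN 0 [] (by simp) one (by simp [ev, one]))
        · simpa using this
        · intro a ha b hb
          have ha' : (ev w * c.prod)⁻¹ * ev a ∈ H := ha
          have hb' : ev b = 1 := hb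
          change (g : G)⁻¹ * ev (a ++ b) ∈ H
          rw [hev, hb', ← hgp, mul_one, mul_inv_rev, mul_assoc]
          exact H.mul_mem (H.inv_mem hW2) ha'
      · obtain ⟨u, u', rfl, rfl, rfl⟩ := List.map_eq_append_iff.1 hc
        simp only [List.length_append, List.length_map] at hl hl1 hl2
        have hp2' : ev u' * v.prod ∈ U := by rw [List.prod_append] at hp2; exact hp2
        refine derives_pair L _ _ (.inl ⟨ev u, hp1⟩) (.inr ⟨ev u' * v.prod, hp2'⟩) u u' ?_
          (hN _ u le_rfl _ rfl) (ih u' v (by omega) hv _ rfl)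
        intro a ha b hb
        have ha' : ev a = ev u := ha
        have hb' : (ev u' * v.prod)⁻¹ * ev b ∈ H := hb
        change (g : G)⁻¹ * ev (a ++ b) ∈ H
        rw [hev, ha', ← hg, hev]
        convert hb' using 1
        group
  intro w hw
  have hw' : ev w ∈ H := by
    have : (1 : G)⁻¹ * ev w ∈ H := hw
    simpa using this
  obtain ⟨v, hv, hvp⟩ := hHword _ (H.inv_mem hw')
  exact hM _ w v le_rfl hv one (by rw [hvp]; simp [one])
end

section
/- Let S be a finite type, let F = FreeGroup S be the free group on S, and let K be a finitely generated subgroup of F. Consider the alphabet S × Bool and the evaluation map sending (s, true) to the generator FreeGroup.of s and (s, false) to (FreeGroup.of s)⁻¹. Then the language {w : List (S × Bool) | the product in F of the evaluations of the letters of w lies in K} is context-free. -/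
namespace GWP

open ContextFreeGrammar Pointwise

/-- Nonterminals: `D` for trivial words, `Y a` for words equal to the letter `a`,
`X q` for words in the left coset `q`. -/
inductive NT (S : Type) (Q : Type) : Type
  | D : NT S Q
  | Y : S × Bool → NT S Q
  | X : Q → NT S Q

/-- Inverse letter. -/
def linv {S : Type} (a : S × Bool) : S × Bool := (a.1, !a.2)

abbrev Sy (S : Type) (K : Subgroup (FreeGroup S)) : Type :=
  Symbol (S × Bool) (NT S (FreeGroup S ⧸ K))

abbrev nt {S : Type} {K : Subgroup (FreeGroup S)} (n : NT S (FreeGroup S ⧸ K)) : Sy S K :=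
  Symbol.nonterminal n

abbrev tm {S : Type} {K : Subgroup (FreeGroup S)} (a : S × Bool) : Sy S K :=
  Symbol.terminal a

/-- The rules. -/
def ruleSet {S : Type} (K : Subgroup (FreeGroup S)) (V : Set (FreeGroup S ⧸ K)) :
    Set (ContextFreeRule (S × Bool) (NT S (FreeGroup S ⧸ K))) :=
  {⟨NT.D, []⟩} ∪ {⟨NT.X ((1 : FreeGroup S) : FreeGroup S ⧸ K), [nt NT.D]⟩} ∪
  Set.range (fun a : S × Bool => ⟨NT.D, [tm a, nt (NT.Y (linv a))]⟩) ∪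
  Set.range (fun a : S × Bool => ⟨NT.Y a, [tm a, nt NT.D]⟩) ∪
  Set.range (fun p : (S × Bool) × (S × Bool) =>
    ⟨NT.Y p.1, [tm p.2, nt (NT.Y (linv p.2)), nt (NT.Y p.1)]⟩) ∪
  (fun p : (S × Bool) × (FreeGroup S ⧸ K) =>
    ⟨NT.X (FreeGroup.mk [p.1] • p.2), [nt (NT.Y p.1), nt (NT.X p.2)]⟩) '' (Set.univ ×ˢ V)

lemma ruleSet_finite {S : Type} [Finite S] (K : Subgroup (FreeGroup S))
    (V : Set (FreeGroup S ⧸ K)) (hV : V.Finite) : (ruleSet K V).Finite := by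
  unfold ruleSet
  refine Set.Finite.union (Set.Finite.union (Set.Finite.union (Set.Finite.union
    (Set.Finite.union ?_ ?_) ?_) ?_) ?_) ?_
  · exact Set.finite_singleton _
  · exact Set.finite_singleton _
  · exact Set.finite_range _
  · exact Set.finite_range _
  · exact Set.finite_range _
  · exact (Set.finite_univ.prod hV).image _

/-- The grammar. -/
noncomputable def gram {S : Type} [Finite S] (K : Subgroup (FreeGroup S))
    (V : Set (FreeGroup S ⧸ K)) (hV : V.Finite) : ContextFreeGrammar (S × Bool) where
  NT := NT S (FreeGroup S ⧸ K)
  initial := NT.X ((1 : FreeGroup S) : FreeGroup S ⧸ K)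
  rules := (ruleSet_finite K V hV).toFinset

/-- Semantics of symbols. -/
def sem {S : Type} {K : Subgroup (FreeGroup S)} : Sy S K → Set (FreeGroup S)
  | .terminal a => {FreeGroup.mk [a]}
  | .nonterminal .D => {1}
  | .nonterminal (.Y a) => {FreeGroup.mk [a]}
  | .nonterminal (.X q) => {g | (g : FreeGroup S ⧸ K) = q}

def semL {S : Type} {K : Subgroup (FreeGroup S)} (l : List (Sy S K)) : Set (FreeGroup S) :=
  (l.map sem).prod

lemma mk_linv {S : Type} (a : S × Bool) :
    (FreeGroup.mk [linv a] : FreeGroup S) = (FreeGroup.mk [a])⁻¹ := by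
  simp [linv, FreeGroup.invRev]

lemma mk_cons {S : Type} (a : S × Bool) (w : List (S × Bool)) :
    (FreeGroup.mk (a :: w) : FreeGroup S) = FreeGroup.mk [a] * FreeGroup.mk w := by
  simp [FreeGroup.mul_mk]

lemma semL_rule {S : Type} {K : Subgroup (FreeGroup S)} {V : Set (FreeGroup S ⧸ K)}
    (r : ContextFreeRule (S × Bool) (NT S (FreeGroup S ⧸ K))) (hr : r ∈ ruleSet K V) :
    semL r.output ⊆ semL [nt (K := K) r.input] := by
  rcases hr with ((((hr | hr) | ⟨a, rfl⟩) | ⟨a, rfl⟩) | ⟨p, rfl⟩) | ⟨⟨a, q⟩, _, rfl⟩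
  · rw [Set.mem_singleton_iff] at hr
    subst hr
    intro x hx
    simpa [semL, sem] using hx
  · rw [Set.mem_singleton_iff] at hr
    subst hr
    intro x hx
    simp only [semL, sem, List.map_cons, List.map_nil, List.prod_cons, List.prod_nil, mul_one,
      Set.mem_singleton_iff] at hx
    subst hx
    simp [semL, sem]
  · intro x hx
    simp only [semL, sem, List.map_cons, List.map_nil, List.prod_cons, List.prod_nil, mul_one,
      mk_linv, Set.singleton_mul_singleton, mul_inv_cancel] at hx ⊢
    exact hx
  · intro x hx
    simp only [semL, sem, List.map_cons, List.map_nil, List.prod_cons, List.prod_nil, mul_one,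
      Set.singleton_mul_singleton] at hx ⊢
    exact hx
  · intro x hx
    simp only [semL, sem, List.map_cons, List.map_nil, List.prod_cons, List.prod_nil, mul_one,
      mk_linv, Set.singleton_mul_singleton, mul_inv_cancel_left] at hx ⊢
    exact hx
  · intro x hx
    simp only [semL, sem, List.map_cons, List.map_nil, List.prod_cons, List.prod_nil, mul_one]
      at hx ⊢
    obtain ⟨y, hy, z, hz, rfl⟩ := Set.mem_mul.1 hx
    rw [Set.mem_singleton_iff] at hy
    subst hy
    have hz' : (z : FreeGroup S ⧸ K) = q := hz
    subst hz'
    rfl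

lemma semL_append {S : Type} {K : Subgroup (FreeGroup S)} (u v : List (Sy S K)) :
    semL (u ++ v) = semL u * semL v := by
  simp [semL]

lemma sound {S : Type} [Finite S] (K : Subgroup (FreeGroup S))
    (V : Set (FreeGroup S ⧸ K)) (hV : V.Finite) (u v : List (Sy S K))
    (h : (gram K V hV).Derives u v) : semL v ⊆ semL u := by
  induction h with
  | refl => exact subset_rfl
  | tail _ h ih =>
    refine subset_trans ?_ ih
    obtain ⟨r, hr, hrw⟩ := h
    obtain ⟨p, q, rfl, rfl⟩ := hrw.exists_parts
    have hr' : r ∈ ruleSet K V := (Set.Finite.mem_toFinset _).1 hr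
    have := semL_rule r hr'
    erw [semL_append, semL_append, semL_append, semL_append]
    exact Set.mul_subset_mul_right (Set.mul_subset_mul_left this)

lemma semL_terminal {S : Type} {K : Subgroup (FreeGroup S)} (w : List (S × Bool)) :
    semL (w.map (tm (K := K))) = {FreeGroup.mk w} := by
  induction w with
  | nil => rfl
  | cons a w ih =>
    rw [mk_cons, ← Set.singleton_mul_singleton, ← ih]
    simp [semL, sem]

section complete

variable {S : Type} [Finite S] {K : Subgroup (FreeGroup S)}
    {V : Set (FreeGroup S ⧸ K)} {hV : V.Finite}

/-- Derivability, with plain types. -/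
def Der (K : Subgroup (FreeGroup S)) (V : Set (FreeGroup S ⧸ K)) (hV : V.Finite)
    (u v : List (Sy S K)) : Prop := (gram K V hV).Derives u v

lemma Der.rule {n : NT S (FreeGroup S ⧸ K)} {o v : List (Sy S K)}
    (h : (⟨n, o⟩ : ContextFreeRule _ _) ∈ ruleSet K V) (h2 : Der K V hV o v) :
    Der K V hV [nt n] v := by
  refine Produces.trans_derives (g := gram K V hV) ⟨⟨n, o⟩, ?_, ?_⟩ h2
  · exact (Set.Finite.mem_toFinset _).2 h
  · exact ContextFreeRule.Rewrites.input_output (r := ⟨n, o⟩)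

lemma Der.app {a b c d : List (Sy S K)} (h1 : Der K V hV a b) (h2 : Der K V hV c d) :
    Der K V hV (a ++ c) (b ++ d) :=
  (Derives.append_right (g := gram K V hV) h1 c).trans
    (Derives.append_left (g := gram K V hV) h2 b)

lemma Der.refl (a : List (Sy S K)) : Der K V hV a a := Relation.ReflTransGen.refl

lemma red_of_mk_eq {w r : List (S × Bool)} (hr : FreeGroup.IsReduced r)
    (h : FreeGroup.mk w = FreeGroup.mk r) : FreeGroup.Red w r := by
  obtain ⟨c, h1, h2⟩ := FreeGroup.Red.exact.1 h
  rw [FreeGroup.IsReduced.red_iff_eq hr] at h2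
  exact h2 ▸ h1

lemma complete_DY (n : ℕ) : ∀ w : List (S × Bool), w.length ≤ n →
    (FreeGroup.mk w = (1 : FreeGroup S) → Der K V hV [nt NT.D] (w.map tm)) ∧
    ∀ a, (FreeGroup.mk w : FreeGroup S) = FreeGroup.mk [a] →
      Der K V hV [nt (NT.Y a)] (w.map tm) := by
  induction n with
  | zero =>
    intro w hw
    have : w = [] := List.length_eq_zero_iff.1 (by omega)
    subst this
    refine ⟨fun _ => Der.rule (o := []) (by simp [ruleSet]) (Der.refl _), fun a ha => ?_⟩
    have := red_of_mk_eq (w := []) (r := [a]) (by simp) ha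
    exact absurd (FreeGroup.Red.nil_iff.1 this) (by simp)
  | succ n ih =>
    intro w hw
    cases w with
    | nil => exact ih _ (by simp)
    | cons b w =>
      have hw' : w.length ≤ n := by simpa using hw
      constructor
      · intro h
        refine Der.rule (o := [tm b] ++ [nt (NT.Y (linv b))]) (by simp [ruleSet]) ?_
        refine Der.app (Der.refl [tm b]) ((ih w hw').2 _ ?_)
        rw [mk_linv]
        rw [mk_cons] at h
        exact eq_inv_of_mul_eq_one_right h
      · intro a h
        by_cases hab : b = a
        · subst hab
          refine Der.rule (o := [tm b] ++ [nt NT.D]) (by simp [ruleSet]) ?_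
          refine Der.app (Der.refl [tm b]) ((ih w hw').1 ?_)
          rw [mk_cons] at h
          exact mul_eq_left.1 h
        · have hred : FreeGroup.IsReduced [linv b, a] := by
            rw [FreeGroup.isReduced_cons_cons]
            refine ⟨?_, by simp⟩
            intro h1
            by_contra h2
            apply hab
            ext
            · exact h1
            · simp only [linv] at h2
              revert h2
              cases b.2 <;> cases a.2 <;> simp
          have hw2 : (FreeGroup.mk w : FreeGroup S) = FreeGroup.mk [linv b, a] := by
            rw [mk_cons (linv b), mk_linv, ← h, mk_cons b w, inv_mul_cancel_left]
          have hR := red_of_mk_eq hred hw2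
          obtain ⟨w1, w2, rfl, h1, h2⟩ :=
            FreeGroup.Red.to_append_iff (L₁ := [linv b]) (L₂ := [a]).1 hR
          rw [List.length_append] at hw'
          refine Der.rule (o := [tm b] ++ ([nt (NT.Y (linv b))] ++ [nt (NT.Y a)])) ?_ ?_
          · refine Or.inl (Or.inr ⟨(a, b), rfl⟩)
          · rw [List.map_cons, List.map_append]
            refine Der.app (Der.refl [tm b]) (Der.app ?_ ?_)
            · exact (ih w1 (by omega)).2 _ (FreeGroup.Red.exact.2 ⟨_, h1, .refl⟩)
            · exact (ih w2 (by omega)).2 _ (FreeGroup.Red.exact.2 ⟨_, h2, .refl⟩)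

/-- All suffixes of `z` represent cosets in `V`. -/
def Good (K : Subgroup (FreeGroup S)) (V : Set (FreeGroup S ⧸ K)) (z : List (S × Bool)) : Prop :=
  ∀ s, s <:+ z → ((FreeGroup.mk s : FreeGroup S) : FreeGroup S ⧸ K) ∈ V

lemma complete_X (r : List (S × Bool)) : Good K V r → ∀ w, FreeGroup.Red w r →
    Der K V hV [nt (NT.X ((FreeGroup.mk r : FreeGroup S) : FreeGroup S ⧸ K))] (w.map tm) := by
  induction r with
  | nil =>
    intro _ w hw
    refine Der.rule (o := [nt NT.D]) (Or.inl (Or.inl (Or.inl (Or.inl (Or.inr rfl))))) ?_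
    exact (complete_DY _ w le_rfl).1 (FreeGroup.Red.exact.2 ⟨_, hw, .refl⟩)
  | cons a r ih =>
    intro hg w hw
    obtain ⟨w1, w2, rfl, h1, h2⟩ :=
      FreeGroup.Red.to_append_iff (L₁ := [a]) (L₂ := r).1 hw
    refine Der.rule (o := [nt (NT.Y a)] ++
      [nt (NT.X ((FreeGroup.mk r : FreeGroup S) : FreeGroup S ⧸ K))]) ?_ ?_
    · refine Or.inr ⟨(a, ((FreeGroup.mk r : FreeGroup S) : FreeGroup S ⧸ K)),
        ⟨trivial, hg _ (List.suffix_cons _ _)⟩, ?_⟩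
      rw [mk_cons]
      rfl
    · rw [List.map_append]
      refine Der.app ?_ (ih (fun s hs => hg s (hs.trans (List.suffix_cons _ _))) _ h2)
      exact (complete_DY _ w1 le_rfl).2 _ (FreeGroup.Red.exact.2 ⟨_, h1, .refl⟩)

lemma suffix_append_cases {α : Type} {s l1 l2 : List α} (h : s <:+ l1 ++ l2) :
    s <:+ l2 ∨ ∃ t, t <:+ l1 ∧ s = t ++ l2 := by
  obtain ⟨p, hp⟩ := h
  rcases List.append_eq_append_iff.1 hp with ⟨c, h1, h2⟩ | ⟨c, h1, h2⟩
  · exact Or.inr ⟨c, ⟨p, h1.symm⟩, h2⟩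
  · exact Or.inl ⟨c, h2.symm⟩

lemma Good.red {z r : List (S × Bool)} (hz : Good K V z) (h : FreeGroup.Red z r) :
    Good K V r := by
  induction h with
  | refl => exact hz
  | tail _ h ih =>
    cases h with
    | @not L1 L2 x b =>
      intro s hs
      rcases suffix_append_cases hs with h | ⟨t, ht, rfl⟩
      · refine ih s (h.trans ?_)
        exact ⟨L1 ++ [(x, b), (x, !b)], by simp⟩
      · have h1 := ih (t ++ (x, b) :: (x, !b) :: L2) (by
          obtain ⟨p, rfl⟩ := ht
          exact ⟨p, by simp⟩)
        rwa [FreeGroup.Red.exact.2 ⟨_, .single .not, .refl⟩] at h1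

lemma Good.append {y z : List (S × Bool)} (hy : Good K V y) (hz : Good K V z)
    (hK : (FreeGroup.mk z : FreeGroup S) ∈ K) : Good K V (y ++ z) := by
  intro s hs
  rcases suffix_append_cases hs with h | ⟨t, ht, rfl⟩
  · exact hz s h
  · rw [← FreeGroup.mul_mk, QuotientGroup.mk_mul_of_mem _ hK]
    exact hy t ht

end complete

lemma prod_eq_mk {S : Type} (w : List (S × Bool)) :
    (w.map (fun p => if p.2 then FreeGroup.of p.1 else (FreeGroup.of p.1)⁻¹)).prod
      = FreeGroup.mk w := by
  induction w with
  | nil => rfl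
  | cons a w ih =>
    rw [mk_cons, List.map_cons, List.prod_cons, ih]
    rcases a with ⟨s, _ | _⟩ <;> rfl

end GWP

open GWP

/-- For a finitely generated subgroup `K` of a free group `FreeGroup S` with `S` finite,
the generalised word problem of `K` over the alphabet `S × Bool` is context-free. -/
theorem gwp_fg_subgroup_freeGroup_contextFree
    (S : Type) [Fintype S] (K : Subgroup (FreeGroup S)) (hK : K.FG) :
    Language.IsContextFree
      {w : List (S × Bool) |
        (w.map (fun p => if p.2 then FreeGroup.of p.1 else (FreeGroup.of p.1)⁻¹)).prod ∈ K} := by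
  classical
  obtain ⟨T, hT⟩ := hK
  let U : Set (FreeGroup S) := ↑T ∪ (fun x => x⁻¹) '' (T : Set (FreeGroup S))
  have hU : U.Finite := T.finite_toSet.union (T.finite_toSet.image _)
  let V : Set (FreeGroup S ⧸ K) := insert ((1 : FreeGroup S) : FreeGroup S ⧸ K)
    (⋃ g ∈ U, (fun s => ((FreeGroup.mk s : FreeGroup S) : FreeGroup S ⧸ K)) ''
      {s | s <:+ g.toWord})
  have hV : V.Finite := by
    refine Set.Finite.insert _ (hU.biUnion fun g _ => Set.Finite.image _ ?_)
    refine (List.finite_toSet g.toWord.tails).subset ?_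
    intro s hs
    simpa using hs
  have hgoodU : ∀ g ∈ U, Good K V g.toWord := by
    intro g hg s hs
    refine Or.inr ?_
    simp only [Set.mem_iUnion]
    exact ⟨g, hg, s, hs, rfl⟩
  have hgood : ∀ g ∈ K, ∃ z, FreeGroup.mk z = g ∧ Good K V z := by
    intro g hg
    have hg' := hg
    rw [← hT] at hg'
    induction hg' using Subgroup.closure_induction_left with
    | one =>
      refine ⟨[], rfl, ?_⟩
      intro s hs
      rw [List.suffix_nil] at hs
      subst hs
      exact Or.inl rfl
    | mul_left x hx y hy ih =>
      rw [hT] at hy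
      obtain ⟨z, hz, hgz⟩ := ih hy
      refine ⟨x.toWord ++ z, ?_, (hgoodU x (Or.inl hx)).append hgz (hz ▸ hy)⟩
      rw [← FreeGroup.mul_mk, FreeGroup.mk_toWord, hz]
    | inv_mul_cancel x hx y hy ih =>
      rw [hT] at hy
      obtain ⟨z, hz, hgz⟩ := ih hy
      refine ⟨x⁻¹.toWord ++ z, ?_,
        (hgoodU x⁻¹ (Or.inr ⟨x, hx, rfl⟩)).append hgz (hz ▸ hy)⟩
      rw [← FreeGroup.mul_mk, FreeGroup.mk_toWord, hz]
  refine ⟨gram K V hV, ?_⟩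
  ext w
  rw [ContextFreeGrammar.mem_language_iff]
  change _ ↔ (w.map (fun p => if p.2 then FreeGroup.of p.1 else (FreeGroup.of p.1)⁻¹)).prod ∈ K
  rw [prod_eq_mk]
  constructor
  · intro h
    have h1 := sound K V hV _ _ h
    have h2 : FreeGroup.mk w ∈ semL (w.map (tm (K := K))) := by
      rw [semL_terminal]; rfl
    have h3 := h1 h2
    have h4 : ((FreeGroup.mk w : FreeGroup S) : FreeGroup S ⧸ K) = ((1 : FreeGroup S) : _) := by
      obtain ⟨y, hy, e, he, hye⟩ := Set.mem_mul.1 h3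
      have he' : e = 1 := he
      rw [he', mul_one] at hye
      rw [← hye]
      exact hy
    rw [eq_comm, QuotientGroup.eq] at h4
    simpa using h4
  · intro h
    obtain ⟨z, hz, hgz⟩ := hgood _ h
    obtain ⟨r, hwr, hzr⟩ := FreeGroup.Red.exact.1 hz.symm
    have h5 := complete_X (hV := hV) r (hgz.red hzr) w hwr
    have h6 : ((FreeGroup.mk r : FreeGroup S) : FreeGroup S ⧸ K) = ((1 : FreeGroup S) : _) := by
      rw [eq_comm, QuotientGroup.eq]
      have : FreeGroup.mk w = FreeGroup.mk r := FreeGroup.Red.exact.2 ⟨_, hwr, .refl⟩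
      simpa [← this] using h
    rw [h6] at h5
    exact h5
end

section
/- Let S be a finite type and let K be a finitely generated subgroup of the free group FreeGroup S. Then the set of reduced words representing elements of K, namely the language {w : List (S × Bool) | ∃ g ∈ K, FreeGroup.toWord g = w} over the alphabet S × Bool, is a regular language. -/
theorem prefix_append_cases {α : Type} {p a b : List α} (h : p <+: a ++ b) :
    p <+: a ∨ ∃ q, p = a ++ q ∧ q <+: b := by
  rcases List.prefix_or_prefix_of_prefix h (List.prefix_append a b) with h' | ⟨q, rfl⟩
  · exact Or.inl h'
  · exact Or.inr ⟨q, rfl, (List.prefix_append_right_inj a).1 h⟩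

/-- Every prefix of `w` represents an element of `K v` for some `v ∈ V`. -/
def GoodWord {S : Type} (K : Subgroup (FreeGroup S)) (V : Set (FreeGroup S))
    (w : List (S × Bool)) : Prop :=
  ∀ p, p <+: w → ∃ v ∈ V, FreeGroup.mk p * v⁻¹ ∈ K

theorem GoodWord.append {S : Type} {K : Subgroup (FreeGroup S)} {V : Set (FreeGroup S)}
    {w₁ w₂ : List (S × Bool)} (h₁ : GoodWord K V w₁) (hm : FreeGroup.mk w₁ ∈ K)
    (h₂ : GoodWord K V w₂) : GoodWord K V (w₁ ++ w₂) := by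
  intro p hp
  rcases prefix_append_cases hp with h | ⟨q, rfl, hq⟩
  · exact h₁ p h
  · obtain ⟨v, hv, hk⟩ := h₂ q hq
    refine ⟨v, hv, ?_⟩
    rw [← FreeGroup.mul_mk, mul_assoc]
    exact K.mul_mem hm hk

theorem GoodWord.inv {S : Type} {K : Subgroup (FreeGroup S)} {V : Set (FreeGroup S)}
    {w : List (S × Bool)} (h : GoodWord K V w) (hm : FreeGroup.mk w ∈ K) :
    GoodWord K V (FreeGroup.invRev w) := by
  rintro p ⟨s, hs⟩
  have hw : w = FreeGroup.invRev s ++ FreeGroup.invRev p := by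
    rw [← FreeGroup.invRev_append, hs, FreeGroup.invRev_invRev]
  obtain ⟨v, hv, hk⟩ := h (FreeGroup.invRev s) ⟨_, hw.symm⟩
  refine ⟨v, hv, ?_⟩
  have : FreeGroup.mk p * v⁻¹ = (FreeGroup.mk w)⁻¹ * (FreeGroup.mk (FreeGroup.invRev s) * v⁻¹) := by
    rw [hw, ← FreeGroup.mul_mk, ← FreeGroup.inv_mk, ← FreeGroup.inv_mk]
    group
  rw [this]
  exact K.mul_mem (K.inv_mem hm) hk

theorem GoodWord.step {S : Type} {K : Subgroup (FreeGroup S)} {V : Set (FreeGroup S)}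
    {w w' : List (S × Bool)} (h : GoodWord K V w) (hr : FreeGroup.Red.Step w w') :
    GoodWord K V w' := by
  cases hr with
  | @not L₁ L₂ x b =>
    intro p hp
    rcases prefix_append_cases hp with h' | ⟨q, rfl, hq⟩
    · exact h p (h'.trans (List.prefix_append _ _))
    · have := h (L₁ ++ (x, b) :: (x, !b) :: q) (by simpa using hq)
      rwa [show FreeGroup.mk (L₁ ++ (x, b) :: (x, !b) :: q) = FreeGroup.mk (L₁ ++ q) from
        Quot.sound FreeGroup.Red.Step.not] at this

theorem GoodWord.red {S : Type} {K : Subgroup (FreeGroup S)} {V : Set (FreeGroup S)}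
    {w w' : List (S × Bool)} (h : GoodWord K V w) (hr : FreeGroup.Red w w') :
    GoodWord K V w' := by
  induction hr with
  | refl => exact h
  | tail _ hs ih => exact ih.step hs

theorem exists_finite_goodWord {S : Type} [DecidableEq S] (K : Subgroup (FreeGroup S))
    (hK : K.FG) : ∃ V : Set (FreeGroup S), V.Finite ∧ ∀ g ∈ K, GoodWord K V g.toWord := by
  obtain ⟨T, rfl⟩ := hK
  refine ⟨{1} ∪ ⋃ s ∈ T, Set.image FreeGroup.mk {p | p ∈ s.toWord.inits}, ?_, ?_⟩
  · refine (Set.finite_singleton _).union (T.finite_toSet.biUnion fun s _ => ?_)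
    exact (List.finite_toSet _).image _
  · intro g hg
    induction hg using Subgroup.closure_induction with
    | mem x hx =>
      intro p hp
      refine ⟨FreeGroup.mk p, Or.inr ?_, by rw [mul_inv_cancel]; exact one_mem _⟩
      simp only [Set.mem_iUnion]
      exact ⟨x, hx, p, by simpa using hp, rfl⟩
    | one =>
      intro p hp
      simp at hp
      subst hp
      exact ⟨1, Or.inl rfl, by simp [← FreeGroup.one_eq_mk]⟩
    | mul x y hx hy ihx ihy =>
      rw [FreeGroup.toWord_mul]
      exact (ihx.append (by rwa [FreeGroup.mk_toWord]) ihy).red FreeGroup.reduce.red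
    | inv x hx ih =>
      rw [FreeGroup.toWord_inv]
      exact ih.inv (by rwa [FreeGroup.mk_toWord])

/-- For a finitely generated subgroup `K` of a free group `FreeGroup S` with `S` finite,
the set of reduced words representing elements of `K` is a regular language. -/
theorem reducedWords_of_fg_subgroup_regular
    (S : Type) [Fintype S] [DecidableEq S] (K : Subgroup (FreeGroup S)) (hK : K.FG) :
    Language.IsRegular {w : List (S × Bool) | ∃ g ∈ K, FreeGroup.toWord g = w} := by
  obtain ⟨V, hV, hgood⟩ := exists_finite_goodWord K hK
  have key : ∀ w : List (S × Bool), (∃ g ∈ K, FreeGroup.toWord g = w) ↔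
      FreeGroup.IsReduced w ∧ FreeGroup.mk w ∈ K := by
    intro w
    constructor
    · rintro ⟨g, hg, rfl⟩
      exact ⟨FreeGroup.isReduced_toWord, by rwa [FreeGroup.mk_toWord]⟩
    · rintro ⟨h, hw⟩
      exact ⟨_, hw, by rw [FreeGroup.toWord_mk, h.reduce_eq]⟩
  apply Language.IsRegular.of_finite_range_leftQuotient
  let F : FreeGroup S × Option (S × Bool) → Set (List (S × Bool)) := fun q =>
    {y | FreeGroup.IsReduced y ∧ (∀ a ∈ q.2, ∀ b ∈ y.head?, a.1 = b.1 → a.2 = b.2) ∧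
      q.1 * FreeGroup.mk y ∈ K}
  refine Set.Finite.subset (s := {(∅ : Set (List (S × Bool)))} ∪ Set.image F (V ×ˢ Set.univ))
    ((Set.finite_singleton _).union ((hV.prod Set.finite_univ).image F)) ?_
  rintro _ ⟨x, rfl⟩
  by_cases hne : ∃ y, ∃ g ∈ K, FreeGroup.toWord g = x ++ y
  · right
    obtain ⟨y₀, g, hg, hy₀⟩ := hne
    obtain ⟨v, hv, hk⟩ := hgood g hg x ⟨y₀, hy₀.symm⟩
    have hx : FreeGroup.IsReduced x :=
      (FreeGroup.isReduced_toWord (x := g)).infix (hy₀ ▸ (List.prefix_append x y₀).isInfix)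
    refine ⟨(v, x.getLast?), ⟨hv, trivial⟩, ?_⟩
    refine Set.ext fun y => ?_
    refine Iff.trans ?_ (key (x ++ y)).symm
    have hmem : v * FreeGroup.mk y ∈ K ↔ FreeGroup.mk (x ++ y) ∈ K := by
      rw [← K.mul_mem_cancel_left hk, ← FreeGroup.mul_mk]
      simp [mul_assoc]
    have hred : FreeGroup.IsReduced (x ++ y) ↔ FreeGroup.IsReduced x ∧ FreeGroup.IsReduced y ∧
        ∀ a ∈ x.getLast?, ∀ b ∈ y.head?, a.1 = b.1 → a.2 = b.2 := List.isChain_append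
    rw [hred, ← hmem]
    show (_ ∧ _ ∧ _) ↔ _
    tauto
  · left
    refine Set.ext fun y => ?_
    exact ⟨fun h => hne ⟨y, h⟩, fun h => h.elim⟩
end

section
/- Let S be a finite type and let K be a finitely generated subgroup of the free group FreeGroup S. Then K is quasiconvex with respect to reduced words: there exists a constant d : ℕ such that for every g ∈ K and every n ≤ (FreeGroup.toWord g).length, the element p of FreeGroup S represented by the length-n prefix of FreeGroup.toWord g satisfies: there exists k ∈ K with (FreeGroup.toWord (k⁻¹ * p)).length ≤ d. -/
/-- `p` lies within distance `d` of `K`. -/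
def NearSub {S : Type} [DecidableEq S] (K : Subgroup (FreeGroup S)) (d : ℕ)
    (p : FreeGroup S) : Prop :=
  ∃ k ∈ K, (k⁻¹ * p).norm ≤ d

/-- All prefixes of the word `L` are near `K`. -/
def PrefNear {S : Type} [DecidableEq S] (K : Subgroup (FreeGroup S)) (d : ℕ)
    (L : List (S × Bool)) : Prop :=
  ∀ A B, L = A ++ B → NearSub K d (FreeGroup.mk A)

theorem NearSub.mul {S : Type} [DecidableEq S] {K : Subgroup (FreeGroup S)} {d : ℕ}
    {p g : FreeGroup S} (hg : g ∈ K) (h : NearSub K d p) : NearSub K d (g * p) := by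
  obtain ⟨k, hk, hn⟩ := h
  refine ⟨g * k, K.mul_mem hg hk, ?_⟩
  have : (g * k)⁻¹ * (g * p) = k⁻¹ * p := by group
  rwa [this]

theorem PrefNear.step {S : Type} [DecidableEq S] {K : Subgroup (FreeGroup S)} {d : ℕ}
    {L M : List (S × Bool)} (hs : FreeGroup.Red.Step L M) (h : PrefNear K d L) :
    PrefNear K d M := by
  obtain @⟨L1, L2, x, b⟩ := hs
  intro A B hAB
  rcases List.append_eq_append_iff.1 hAB with ⟨a, rfl, h2⟩ | ⟨c, h1, h2⟩
  · have := h (L1 ++ (x, b) :: (x, !b) :: a) B (by simp [h2])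
    have e : FreeGroup.mk (L1 ++ (x, b) :: (x, !b) :: a) = FreeGroup.mk (L1 ++ a) :=
      Quot.sound FreeGroup.Red.Step.not
    rwa [e] at this
  · exact h A (c ++ (x, b) :: (x, !b) :: L2) (by simp [h1])

theorem PrefNear.red {S : Type} [DecidableEq S] {K : Subgroup (FreeGroup S)} {d : ℕ}
    {L M : List (S × Bool)} (hs : FreeGroup.Red L M) (h : PrefNear K d L) :
    PrefNear K d M := by
  induction hs with
  | refl => exact h
  | tail _ h2 ih => exact ih.step h2

/-- A finitely generated subgroup `K` of a free group is quasiconvex with respect to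
reduced words: prefixes of reduced words representing elements of `K` lie within a
bounded distance of `K`. -/
theorem fg_subgroup_freeGroup_quasiconvex
    (S : Type) [Fintype S] [DecidableEq S] (K : Subgroup (FreeGroup S)) (hK : K.FG) :
    ∃ d : ℕ, ∀ g ∈ K, ∀ n ≤ (FreeGroup.toWord g).length,
      ∃ k ∈ K,
        (FreeGroup.toWord (k⁻¹ * FreeGroup.mk ((FreeGroup.toWord g).take n))).length ≤ d := by
  obtain ⟨F, hF⟩ := hK
  refine ⟨F.sup FreeGroup.norm, fun g hg n hn => ?_⟩
  have key : ∃ L, FreeGroup.mk L = g ∧ PrefNear K (F.sup FreeGroup.norm) L := by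
    clear hn
    have hg' := hg
    rw [← hF] at hg'
    induction hg' using Subgroup.closure_induction with
    | mem x hx =>
      refine ⟨x.toWord, FreeGroup.mk_toWord, fun A B hAB => ⟨1, K.one_mem, ?_⟩⟩
      have h1 : x.norm ≤ F.sup FreeGroup.norm := Finset.le_sup (f := FreeGroup.norm) hx
      have h2 : (FreeGroup.mk A).norm ≤ A.length := FreeGroup.norm_mk_le
      have h3 : x.norm = A.length + B.length := by simp [FreeGroup.norm, hAB]
      rw [inv_one, one_mul]
      omega
    | one =>
      refine ⟨[], rfl, fun A B hAB => ⟨1, K.one_mem, ?_⟩⟩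
      obtain ⟨rfl, rfl⟩ := List.append_eq_nil_iff.1 hAB.symm
      rw [← FreeGroup.one_eq_mk]
      simp
    | mul x y hx hy ihx ihy =>
      rw [hF] at hx hy
      obtain ⟨L, hL, pL⟩ := ihx hx
      obtain ⟨M, hM, pM⟩ := ihy hy
      refine ⟨L ++ M, by rw [← FreeGroup.mul_mk, hL, hM], fun A B hAB => ?_⟩
      rcases List.append_eq_append_iff.1 hAB with ⟨a, rfl, h2⟩ | ⟨c, h1, h2⟩
      · rw [← FreeGroup.mul_mk, hL]
        exact (pM a B h2).mul hx
      · exact pL A c h1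
    | inv x hx ihx =>
      rw [hF] at hx
      obtain ⟨L, hL, pL⟩ := ihx hx
      refine ⟨FreeGroup.invRev L, by rw [← FreeGroup.inv_mk, hL], fun A B hAB => ?_⟩
      have hL2 : L = FreeGroup.invRev B ++ FreeGroup.invRev A := by
        rw [← FreeGroup.invRev_append, ← hAB, FreeGroup.invRev_invRev]
      have h := (pL _ _ hL2).mul (K.inv_mem hx)
      have e : FreeGroup.mk A = x⁻¹ * FreeGroup.mk (FreeGroup.invRev B) := by
        rw [← hL, FreeGroup.inv_mk, hAB, ← FreeGroup.mul_mk, ← FreeGroup.inv_mk]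
        group
      rwa [e]
  obtain ⟨L, rfl, pL⟩ := key
  exact (pL.red FreeGroup.reduce.red) _ _ (List.take_append_drop n _).symm
end

section
/- Let G be a group, X a finite type, and φ : X → G a map such that the submonoid of G generated by the image of φ is all of G. Let H be a subgroup of G. Then the generalised word problem GWP(G,H,X) = {w : List X | the product in G of the φ-images of the letters of w lies in H} is a regular language if and only if H has finite index in G. -/
/-- The generalised word problem `GWP(G,H,X)` is a regular language if and only if
`H` has finite index in `G`. -/
theorem gwp_regular_iff_finiteIndex
    (G : Type) [Group G] (X : Type) [Fintype X] (φ : X → G)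
    (hgen : Submonoid.closure (Set.range φ) = ⊤) (H : Subgroup G) :
    Language.IsRegular {w : List X | (w.map φ).prod ∈ H} ↔ Finite (G ⧸ H) := by
  have hsurj : ∀ g : G, ∃ w : List X, (w.map φ).prod = g := by
    intro g
    have hg : g ∈ Submonoid.closure (Set.range φ) := by rw [hgen]; trivial
    induction hg using Submonoid.closure_induction with
    | mem x hx =>
      obtain ⟨a, rfl⟩ := hx
      exact ⟨[a], by simp⟩
    | one => exact ⟨[], by simp⟩
    | mul x y _ _ hx hy =>
      obtain ⟨u, rfl⟩ := hx
      obtain ⟨v, rfl⟩ := hy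
      exact ⟨u ++ v, by simp⟩
  let L : Language X := {w : List X | (w.map φ).prod ∈ H}
  change L.IsRegular ↔ _
  rw [Language.isRegular_iff_finite_range_leftQuotient]
  have hmem : ∀ x y : List X, y ∈ L.leftQuotient x ↔ (x.map φ).prod * (y.map φ).prod ∈ H := by
    intro x y
    rw [Language.mem_leftQuotient, ← List.prod_append, ← List.map_append]
    exact Iff.rfl
  let f : List X → G ⧸ H := fun w => (((w.map φ).prod⁻¹ : G) : G ⧸ H)
  have hf : Function.Surjective f := by
    intro c
    obtain ⟨g, rfl⟩ := QuotientGroup.mk_surjective c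
    obtain ⟨w, hw⟩ := hsurj g⁻¹
    exact ⟨w, by simp [f, hw]⟩
  have key : ∀ x y : List X, L.leftQuotient x = L.leftQuotient y ↔ f x = f y := by
    intro x y
    simp only [f]
    rw [QuotientGroup.eq, inv_inv]
    constructor
    · intro h
      obtain ⟨w, hw⟩ := hsurj (y.map φ).prod⁻¹
      have h1 : w ∈ L.leftQuotient y := by
        rw [hmem, hw, mul_inv_cancel]; exact H.one_mem
      rw [← h, hmem, hw] at h1
      exact h1
    · intro h
      ext w
      rw [hmem, hmem, ← H.mul_mem_cancel_left h (y := (y.map φ).prod * (w.map φ).prod)]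
      simp [mul_assoc]
  constructor
  · intro h
    have := h.to_subtype
    refine Finite.of_surjective
      (fun s : Set.range L.leftQuotient => f s.2.choose) ?_
    intro c
    obtain ⟨w, rfl⟩ := hf c
    exact ⟨⟨L.leftQuotient w, w, rfl⟩, (key _ _).1 (Exists.choose_spec (⟨w, rfl⟩ : ∃ y, L.leftQuotient y = L.leftQuotient w))⟩
  · intro h
    refine (Set.finite_range (fun c : G ⧸ H => L.leftQuotient (hf c).choose)).subset ?_
    rintro _ ⟨w, rfl⟩
    exact ⟨f w, (key _ _).2 (hf (f w)).choose_spec⟩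
end

section
/- Let F = FreeGroup (Fin 2) be the free group on two generators, and let H₁ = ⁅⊤, ⊤⁆ be its commutator subgroup. Consider the alphabet (Fin 2) × Bool with the evaluation map sending (i, true) to FreeGroup.of i and (i, false) to (FreeGroup.of i)⁻¹. Then the language {w : List ((Fin 2) × Bool) | the product in F of the evaluations of the letters of w lies in H₁} is NOT context-free. -/
/-- Exponent-sum vector of a letter. -/
def letterVec (p : (Fin 2) × Bool) : ℤ × ℤ :=
  ((if p.1 = 0 then 1 else 0) * (if p.2 then 1 else -1),
   (if p.1 = 0 then 0 else 1) * (if p.2 then 1 else -1))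

/-- Exponent-sum vector of a word. -/
def wordVec (w : List ((Fin 2) × Bool)) : ℤ × ℤ := (w.map letterVec).sum

theorem wordVec_append (u v : List ((Fin 2) × Bool)) :
    wordVec (u ++ v) = wordVec u + wordVec v := by
  simp [wordVec]

/-- The exponent-sum homomorphism. -/
def expHom : FreeGroup (Fin 2) →* Multiplicative (ℤ × ℤ) :=
  FreeGroup.lift (fun i => Multiplicative.ofAdd (letterVec (i, true)))

theorem expHom_word (w : List ((Fin 2) × Bool)) :
    expHom (w.map (fun p => if p.2 then FreeGroup.of p.1 else (FreeGroup.of p.1)⁻¹)).prod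
      = Multiplicative.ofAdd (wordVec w) := by
  induction w with
  | nil => simp [wordVec]
  | cons p w ih =>
    rw [List.map_cons, List.prod_cons, map_mul, ih]
    have : wordVec (p :: w) = letterVec p + wordVec w := by simp [wordVec]
    rw [this, ofAdd_add]
    congr 1
    obtain ⟨i, b⟩ := p
    cases b
    · simp only [expHom, Bool.false_eq_true, if_false, map_inv, FreeGroup.lift_apply_of]
      rw [← ofAdd_neg]
      congr 1
      simp [letterVec]
    · simp [expHom]

theorem wordVec_eq_zero (w : List ((Fin 2) × Bool))
    (h : (w.map (fun p => if p.2 then FreeGroup.of p.1 else (FreeGroup.of p.1)⁻¹)).prod ∈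
          (⁅(⊤ : Subgroup (FreeGroup (Fin 2))), ⊤⁆ : Subgroup (FreeGroup (Fin 2)))) :
    wordVec w = 0 := by
  have h2 := Abelianization.commutator_subset_ker expHom h
  rw [MonoidHom.mem_ker, expHom_word] at h2
  exact h2

/-- The square word. -/
def sqWord (n : ℕ) : List ((Fin 2) × Bool) :=
  List.replicate n (0, true) ++ (List.replicate n (1, true) ++
    (List.replicate n (0, false) ++ List.replicate n (1, false)))

theorem sqWord_mem (n : ℕ) :
    ((sqWord n).map (fun p => if p.2 then FreeGroup.of p.1 else (FreeGroup.of p.1)⁻¹)).prod ∈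
          (⁅(⊤ : Subgroup (FreeGroup (Fin 2))), ⊤⁆ : Subgroup (FreeGroup (Fin 2))) := by
  have := Subgroup.commutator_mem_commutator
    (Subgroup.mem_top ((FreeGroup.of (0 : Fin 2)) ^ n))
    (Subgroup.mem_top ((FreeGroup.of (1 : Fin 2)) ^ n))
  convert this using 1
  simp [sqWord, commutatorElement_def, mul_assoc]

theorem wordVec_take (n i : ℕ) :
    wordVec ((sqWord n).take i) =
      (((min i n : ℕ) : ℤ) - (min (i - n - n) n : ℕ),
        ((min (i - n) n : ℕ) : ℤ) - (min (i - n - n - n) n : ℕ)) := by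
  simp [sqWord, wordVec, List.take_append, List.take_replicate, letterVec, sub_eq_add_neg]

theorem sq_infix (n : ℕ) (x u y : List ((Fin 2) × Bool)) (h : sqWord n = x ++ u ++ y)
    (hu : u.length ≤ n) :
    u.length ≤ (wordVec u).1.natAbs + (wordVec u).2.natAbs := by
  have h1 : x = (sqWord n).take x.length := by rw [h]; simp
  have h2 : x ++ u = (sqWord n).take (x.length + u.length) := by
    rw [h, ← List.length_append, List.take_left]
  have hl : x.length + u.length ≤ n + n + n + n := by
    have := congrArg List.length h
    simp [sqWord] at this
    omega
  have h3 := wordVec_append x u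
  have e1 := wordVec_take n x.length
  have e2 := wordVec_take n (x.length + u.length)
  rw [← h1] at e1
  rw [← h2, h3, e1] at e2
  have a1 := congrArg Prod.fst e2
  have a2 := congrArg Prod.snd e2
  simp only [Prod.fst_add, Prod.snd_add] at a1 a2
  omega

section Grammar

variable {T : Type} (g : ContextFreeGrammar T)

/-- `s` derives `w` with each symbol of `s` yielding a factor of length at most `K`. -/
def ShortYield (K : ℕ) : List (Symbol T g.NT) → List T → Prop
  | [], w => w = []
  | X :: s, w => ∃ u v, w = u ++ v ∧ g.Derives [X] (u.map Symbol.terminal) ∧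
      u.length ≤ K ∧ ShortYield K s v

theorem shortYield_append (K : ℕ) (p q : List (Symbol T g.NT)) (w : List T) :
    ShortYield g K (p ++ q) w ↔
      ∃ x y, w = x ++ y ∧ ShortYield g K p x ∧ ShortYield g K q y := by
  induction p generalizing w with
  | nil => simp [ShortYield]
  | cons X p ih =>
    simp only [List.cons_append, ShortYield, ih]
    constructor
    · rintro ⟨u, v, rfl, h1, h2, x, y, rfl, h3, h4⟩
      exact ⟨u ++ x, y, by simp, ⟨u, x, rfl, h1, h2, h3⟩, h4⟩
    · rintro ⟨_, y, rfl, ⟨u, x, rfl, h1, h2, h3⟩, h4⟩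
      exact ⟨u, x ++ y, by simp, h1, h2, x, y, rfl, h3, h4⟩

theorem derives_append_append {a b c d : List (Symbol T g.NT)} (h : g.Derives a b)
    (h' : g.Derives c d) : g.Derives (a ++ c) (b ++ d) :=
  (h.append_right c).trans (h'.append_left b)

theorem ShortYield.derives (K : ℕ) (p : List (Symbol T g.NT)) (w : List T)
    (h : ShortYield g K p w) :
    g.Derives p (w.map Symbol.terminal) ∧ w.length ≤ p.length * K := by
  induction p generalizing w with
  | nil =>
    simp only [ShortYield] at h
    subst h
    exact ⟨ContextFreeGrammar.Derives.refl _, by simp⟩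
  | cons X p ih =>
    obtain ⟨u, v, rfl, h1, h2, h3⟩ := h
    obtain ⟨h4, h5⟩ := ih v h3
    refine ⟨?_, ?_⟩
    · rw [List.map_append]
      exact derives_append_append g (a := [X]) h1 h4
    · simp only [List.length_append, List.length_cons, Nat.add_mul]
      omega

theorem shortYield_terminal (K : ℕ) (hK : 1 ≤ K) (w : List T) :
    ShortYield g K (w.map Symbol.terminal) w := by
  induction w with
  | nil => simp [ShortYield]
  | cons a w ih =>
    exact ⟨[a], w, rfl, ContextFreeGrammar.Derives.refl _, by simpa using hK, ih⟩

theorem shortYield_of_derives (K m : ℕ) (hK : 1 ≤ K) (w : List T)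
    (hm : ∀ r ∈ g.rules, r.output.length ≤ m)
    (hs : ∀ r ∈ g.rules, ∀ x u y, w = x ++ u ++ y → u.length ≤ m * K →
      g.Derives [Symbol.nonterminal g.initial]
        (x.map Symbol.terminal ++ [Symbol.nonterminal r.input] ++ y.map Symbol.terminal) →
      g.Derives [Symbol.nonterminal r.input] (u.map Symbol.terminal) → u.length ≤ K)
    (s : List (Symbol T g.NT)) (h : g.Derives s (w.map Symbol.terminal))
    (h0 : g.Derives [Symbol.nonterminal g.initial] s) : ShortYield g K s w := by
  induction h using Relation.ReflTransGen.head_induction_on with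
  | refl => exact shortYield_terminal g K hK w
  | head hst htw ih =>
    have ih := ih (h0.trans_produces hst)
    obtain ⟨r, hr, hrw⟩ := hst
    obtain ⟨p, q, rfl, rfl⟩ := hrw.exists_parts
    rw [shortYield_append] at ih
    obtain ⟨x', y, hw, hx', hy⟩ := ih
    rw [shortYield_append] at hx'
    obtain ⟨x, u, rfl, hx, hu⟩ := hx'
    have du := ShortYield.derives g K _ _ hu
    have dx := ShortYield.derives g K _ _ hx
    have dy := ShortYield.derives g K _ _ hy
    have hd : g.Derives [Symbol.nonterminal r.input] (u.map Symbol.terminal) :=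
      ContextFreeGrammar.Produces.trans_derives
        ⟨r, hr, ContextFreeRule.Rewrites.input_output⟩ du.1
    have hlen : u.length ≤ K := by
      refine hs r hr x u y hw (du.2.trans (Nat.mul_le_mul_right _ (hm r hr))) ?_ hd
      exact h0.trans (derives_append_append g
        (derives_append_append g dx.1 (ContextFreeGrammar.Derives.refl _)) dy.1)
    rw [shortYield_append]
    refine ⟨x ++ u, y, hw, ?_, hy⟩
    rw [shortYield_append]
    exact ⟨x, u, rfl, hx, u, [], by simp, hd, hlen, rfl⟩

end Grammar

/-- The generalised word problem of the commutator subgroup of the free group of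
rank 2 is not context-free. -/
theorem gwp_commutatorSubgroup_not_contextFree :
    ¬ Language.IsContextFree
      {w : List ((Fin 2) × Bool) |
        (w.map (fun p => if p.2 then FreeGroup.of p.1 else (FreeGroup.of p.1)⁻¹)).prod ∈
          (⁅(⊤ : Subgroup (FreeGroup (Fin 2))), ⊤⁆ : Subgroup (FreeGroup (Fin 2)))} := by
  rintro ⟨g, hg⟩
  have hL : ∀ w, g.Derives [Symbol.nonterminal g.initial] (w.map Symbol.terminal) →
      wordVec w = 0 := by
    intro w hw
    have : w ∈ g.language := hw
    rw [hg] at this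
    exact wordVec_eq_zero w this
  have hS : ∀ n, g.Derives [Symbol.nonterminal g.initial] ((sqWord n).map Symbol.terminal) := by
    intro n
    have : sqWord n ∈ g.language := by
      rw [hg]
      exact sqWord_mem n
    exact this
  -- each useful nonterminal has a well-defined vector
  have hc : ∀ N : g.NT, ∃ c : ℕ, ∀ x u y : List ((Fin 2) × Bool),
      g.Derives [Symbol.nonterminal g.initial]
        (x.map Symbol.terminal ++ [Symbol.nonterminal N] ++ y.map Symbol.terminal) →
      g.Derives [Symbol.nonterminal N] (u.map Symbol.terminal) →
      (wordVec u).1.natAbs + (wordVec u).2.natAbs ≤ c := by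
    intro N
    by_cases hN : ∃ x y : List ((Fin 2) × Bool), g.Derives [Symbol.nonterminal g.initial]
        (x.map Symbol.terminal ++ [Symbol.nonterminal N] ++ y.map Symbol.terminal)
    · obtain ⟨x, y, hxy⟩ := hN
      refine ⟨(wordVec x + wordVec y).1.natAbs + (wordVec x + wordVec y).2.natAbs, ?_⟩
      intro _ u _ _ hu
      have h1 := hL (x ++ u ++ y) (by
        rw [List.map_append, List.map_append]
        exact hxy.trans ((hu.append_left _).append_right _))
      rw [wordVec_append, wordVec_append] at h1
      have a1 := congrArg Prod.fst h1
      have a2 := congrArg Prod.snd h1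
      simp only [Prod.fst_add, Prod.snd_add, Prod.fst_zero, Prod.snd_zero] at a1 a2 ⊢
      omega
    · exact ⟨0, fun x u y h _ => absurd ⟨x, y, h⟩ hN⟩
  choose c hc using hc
  let K := g.rules.sup (fun r => c r.input) + 1
  let m := g.rules.sup (fun r => r.output.length)
  let n := m * K + K
  have hY := shortYield_of_derives g K m (Nat.le_add_left _ _) (sqWord n)
    (fun r hr => Finset.le_sup (f := fun r => r.output.length) hr)
    (by
      intro r hr x u y hw hu h1 h2
      have e1 := sq_infix n x u y hw (hu.trans (Nat.le_add_right _ _))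
      have e2 := hc r.input x u y h1 h2
      have e3 : c r.input ≤ g.rules.sup (fun r => c r.input) :=
        Finset.le_sup (f := fun r => c r.input) hr
      show u.length ≤ g.rules.sup (fun r => c r.input) + 1
      omega)
    _ (hS n) (ContextFreeGrammar.Derives.refl _)
  have hlen := (ShortYield.derives g K _ _ hY).2
  have hK : 1 ≤ K := Nat.le_add_left _ _
  have hn : K ≤ n := Nat.le_add_left _ _
  simp [sqWord] at hlen
  omega
end

section
/- Let H and K be groups and let G = H ∗ K be their free product (the group coproduct, with canonical injections inl : H → G and inr : K → G). Let h ∈ H with h ≠ 1 and let k ∈ K. Then inl h * inr k * (inl h)⁻¹ lies in the range of inr if and only if k = 1. (This is the algebraic reduction showing that the word problem of K reduces to the membership problem of the subgroup inr(K) in H ∗ K.) -/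
open Classical in
/-- `H` acts on the line `H × {1}` of `H × K`, fixing everything else. -/
noncomputable def leftLineHom (H K : Type) [Group H] [Group K] : H →* Equiv.Perm (H × K) :=
  MonoidHom.toHomPerm
    { toFun := fun a p => if p.2 = 1 then (a * p.1, p.2) else p
      map_one' := by
        funext p
        show (if p.2 = 1 then ((1 : H) * p.1, p.2) else p) = p
        simp
      map_mul' := by
        intro a b
        funext p
        show (if p.2 = 1 then (a * b * p.1, p.2) else p) =
          (fun q : H × K => if q.2 = 1 then (a * q.1, q.2) else q)
            (if p.2 = 1 then (b * p.1, p.2) else p)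
        by_cases hp : p.2 = 1 <;> simp [hp, mul_assoc] }

open Classical in
/-- `K` acts on the line `{1} × K` of `H × K`, fixing everything else. -/
noncomputable def rightLineHom (H K : Type) [Group H] [Group K] : K →* Equiv.Perm (H × K) :=
  MonoidHom.toHomPerm
    { toFun := fun a p => if p.1 = 1 then (p.1, a * p.2) else p
      map_one' := by
        funext p
        show (if p.1 = 1 then (p.1, (1 : K) * p.2) else p) = p
        simp
      map_mul' := by
        intro a b
        funext p
        show (if p.1 = 1 then (p.1, a * b * p.2) else p) =
          (fun q : H × K => if q.1 = 1 then (q.1, a * q.2) else q)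
            (if p.1 = 1 then (p.1, b * p.2) else p)
        by_cases hp : p.1 = 1 <;> simp [hp, mul_assoc] }

open Classical in
theorem leftLineHom_apply (H K : Type) [Group H] [Group K] (a : H) (p : H × K) :
    leftLineHom H K a p = if p.2 = 1 then (a * p.1, p.2) else p := rfl

open Classical in
theorem rightLineHom_apply (H K : Type) [Group H] [Group K] (a : K) (p : H × K) :
    rightLineHom H K a p = if p.1 = 1 then (p.1, a * p.2) else p := rfl

open Monoid.Coprod in
/-- In a free product `H ∗ K`, for `h ∈ H` nontrivial and `k ∈ K`, the conjugate
`inl h * inr k * (inl h)⁻¹` lies in the canonical copy of `K` iff `k = 1`. -/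
theorem conj_mem_inr_range_iff
    (H K : Type) [Group H] [Group K] (h : H) (hh : h ≠ 1) (k : K) :
    Monoid.Coprod.inl h * Monoid.Coprod.inr k * (Monoid.Coprod.inl h)⁻¹ ∈
      (Monoid.Coprod.inr : K →* H ∗ K).range ↔ k = 1 := by
  constructor
  · rintro ⟨k', hk'⟩
    have e : k' = k := by
      have := congrArg (Monoid.Coprod.snd : H ∗ K →* K) hk'
      simpa using this
    subst e
    rw [eq_mul_inv_iff_mul_eq] at hk'
    have h2 := congrArg (Monoid.Coprod.lift (leftLineHom H K) (rightLineHom H K)) hk'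
    rw [map_mul, map_mul, lift_apply_inl, lift_apply_inr] at h2
    have h3 := congrArg (fun f : Equiv.Perm (H × K) => f (1, 1)) h2
    by_contra hk
    simp [Equiv.Perm.mul_apply, leftLineHom_apply, rightLineHom_apply, hh, hk] at h3
  · rintro rfl
    simp
end
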